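/- For all vectors u, v, y, w ∈ ℝ⁸, with A = ⟨u,y⟩⟨v,w⟩ − ⟨u,w⟩⟨v,y⟩ and B = Φ₀(u,v,y,w), the following identity of 8-forms holds: (ι_u ι_v Φ₀) ∧ (y♭ ∧ w♭) ∧ Φ₀ = (−3A − 2B) · vol. -/

import Mathlib

noncomputable section
open scoped RealInnerProductSpace

/-- Euclidean 8-space ℝ⁸. -/
abbrev E8 : Type := EuclideanSpace ℝ (Fin 8)

/-- The alternating 4-form `dx^i ∧ dx^j ∧ dx^k ∧ dx^l` on ℝ⁸, evaluated on four vectors. -/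
def dx4 (i j k l : Fin 8) (v : Fin 4 → E8) : ℝ :=
  Matrix.det (Matrix.of fun a b => v b (![i, j, k, l] a))

/-- The Cayley 4-form `Φ₀` on ℝ⁸ (indices written 0-based, i.e. `dx4 0 1 2 3` is `dx¹²³⁴`). -/
def Phi0 (v : Fin 4 → E8) : ℝ :=
  dx4 0 1 2 3 v + dx4 0 1 4 5 v + dx4 0 1 6 7 v + dx4 0 2 4 6 v
    - dx4 0 2 5 7 v - dx4 0 3 4 7 v - dx4 0 3 5 6 v
    - dx4 1 2 4 7 v - dx4 1 2 5 6 v - dx4 1 3 4 6 v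
    + dx4 1 3 5 7 v + dx4 2 3 4 5 v + dx4 2 3 6 7 v + dx4 4 5 6 7 v

/-- The wedge product of a `p`-form and a `q`-form on ℝ⁸ (forms represented as
functions of tuples of vectors), in the determinant convention: for alternating
`f` and `g` this is the usual exterior product, with `dx¹ ∧ ⋯ ∧ dx⁸ = vol`. -/
def wedge {p q : ℕ} (f : (Fin p → E8) → ℝ) (g : (Fin q → E8) → ℝ)
    (v : Fin (p + q) → E8) : ℝ :=
  ((p.factorial * q.factorial : ℕ) : ℝ)⁻¹ *
    ∑ σ : Equiv.Perm (Fin (p + q)),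
      ((Equiv.Perm.sign σ : ℤ) : ℝ) *
        ((f fun i => v (σ (Fin.castAdd q i))) * g fun j => v (σ (Fin.natAdd p j)))

/-- The standard volume form `vol = dx¹ ∧ ⋯ ∧ dx⁸` on ℝ⁸. -/
def vol (v : Fin 8 → E8) : ℝ := Matrix.det (Matrix.of fun a b => v b a)

/-- The 1-form `u♭ = ⟨u, ·⟩`. -/
def flat (u : E8) (v : Fin 1 → E8) : ℝ := ⟪u, v 0⟫

/-- The contraction 2-form `ι_u ι_v Φ₀ = Φ₀(v, u, ·, ·)`. -/
def iota2 (u v : E8) (z : Fin 2 → E8) : ℝ := Phi0 ![v, u, z 0, z 1]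


/-- The `n`-form `a₀♭ ∧ ⋯ ∧ aₙ₋₁♭` on ℝ⁸. -/
def detForm {n : ℕ} (a v : Fin n → E8) : ℝ :=
  Matrix.det (Matrix.of fun i j => ⟪a i, v j⟫)

/-- The `i`-th standard basis vector of ℝ⁸. -/
abbrev stdVec (i : Fin 8) : E8 := EuclideanSpace.single i 1

section Wedge

variable {p q : ℕ}

theorem wedge_add_left (f f' : (Fin p → E8) → ℝ) (g : (Fin q → E8) → ℝ) :
    wedge (f + f') g = wedge f g + wedge f' g := by
  funext v
  simp only [wedge, Pi.add_apply, add_mul, mul_add, Finset.sum_add_distrib]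

theorem wedge_smul_left (c : ℝ) (f : (Fin p → E8) → ℝ) (g : (Fin q → E8) → ℝ) :
    wedge (c • f) g = c • wedge f g := by
  funext v
  simp only [wedge, Pi.smul_apply, smul_eq_mul, Finset.mul_sum]
  exact Finset.sum_congr rfl fun σ _ => by ring

theorem wedge_sub_left (f f' : (Fin p → E8) → ℝ) (g : (Fin q → E8) → ℝ) :
    wedge (f - f') g = wedge f g - wedge f' g := by
  funext v
  simp only [wedge, Pi.sub_apply, sub_mul, mul_sub, Finset.sum_sub_distrib]

theorem wedge_add_right (f : (Fin p → E8) → ℝ) (g g' : (Fin q → E8) → ℝ) :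
    wedge f (g + g') = wedge f g + wedge f g' := by
  funext v
  simp only [wedge, Pi.add_apply, mul_add, Finset.sum_add_distrib]

theorem wedge_sub_right (f : (Fin p → E8) → ℝ) (g g' : (Fin q → E8) → ℝ) :
    wedge f (g - g') = wedge f g - wedge f g' := by
  funext v
  simp only [wedge, Pi.sub_apply, mul_sub, Finset.sum_sub_distrib]

theorem wedge_detForm (a : Fin p → E8) (b : Fin q → E8) :
    wedge (detForm a) (detForm b) = detForm (Fin.append a b) := by
  funext v
  have key (τ : Equiv.Perm (Fin p)) (ρ : Equiv.Perm (Fin q)) :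
      ∑ σ : Equiv.Perm (Fin (p + q)), ((Equiv.Perm.sign σ : ℤ) : ℝ) *
        ((((Equiv.Perm.sign τ : ℤ) : ℝ) * ∏ i, ⟪a i, v (σ (Fin.castAdd q (τ i)))⟫) *
          (((Equiv.Perm.sign ρ : ℤ) : ℝ) * ∏ j, ⟪b j, v (σ (Fin.natAdd p (ρ j)))⟫)) =
        detForm (Fin.append a b) v := by
    set π : Equiv.Perm (Fin (p + q)) := finSumFinEquiv.permCongr (Equiv.Perm.sumCongr τ ρ)
      with hπ
    have hs : Equiv.Perm.sign π = Equiv.Perm.sign τ * Equiv.Perm.sign ρ := by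
      rw [hπ, Equiv.Perm.sign_permCongr, Equiv.Perm.sign_sumCongr]
    have hl (i : Fin p) : π (Fin.castAdd q i) = Fin.castAdd q (τ i) := by
      simp [hπ, Equiv.permCongr_apply]
    have hr (j : Fin q) : π (Fin.natAdd p j) = Fin.natAdd p (ρ j) := by
      simp [hπ, Equiv.permCongr_apply]
    rw [detForm, ← Matrix.det_transpose, Matrix.det_apply']
    refine Fintype.sum_equiv (Equiv.mulRight π) _ _ fun σ => ?_
    simp only [Equiv.coe_mulRight, Equiv.Perm.sign_mul, hs, Matrix.transpose_apply,
      Matrix.of_apply, Fin.prod_univ_add, Fin.append_left, Fin.append_right,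
      Equiv.Perm.mul_apply, hl, hr]
    push_cast
    ring
  have expand (n : ℕ) (c w : Fin n → E8) : detForm c w =
      ∑ τ : Equiv.Perm (Fin n), ((Equiv.Perm.sign τ : ℤ) : ℝ) * ∏ i, ⟪c i, w (τ i)⟫ := by
    rw [detForm, ← Matrix.det_transpose, Matrix.det_apply']
    rfl
  have hsum : ∑ σ : Equiv.Perm (Fin (p + q)), ((Equiv.Perm.sign σ : ℤ) : ℝ) *
        ((detForm a fun i => v (σ (Fin.castAdd q i))) *
          detForm b fun j => v (σ (Fin.natAdd p j))) =
      ((p.factorial * q.factorial : ℕ) : ℝ) * detForm (Fin.append a b) v := by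
    simp_rw [expand p, expand q, Finset.sum_mul_sum, Finset.mul_sum]
    rw [Finset.sum_comm]
    simp_rw [Finset.sum_comm (s := (Finset.univ : Finset (Equiv.Perm (Fin (p + q)))))]
    simp_rw [key]
    simp [Fintype.card_perm, mul_assoc]
  rw [wedge, hsum, inv_mul_cancel_left₀]
  positivity

end Wedge

theorem inner_stdVec (i : Fin 8) (x : E8) : ⟪stdVec i, x⟫ = x i := by
  simp [EuclideanSpace.inner_single_left]

theorem dx4_eq_detForm (i j k l : Fin 8) :
    dx4 i j k l = detForm ![stdVec i, stdVec j, stdVec k, stdVec l] := by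
  funext v
  refine congrArg Matrix.det (Matrix.ext fun a b => ?_)
  fin_cases a <;> simp [inner_stdVec]

theorem flat_eq_detForm (y : E8) : flat y = detForm ![y] := by
  funext v
  simp [flat, detForm]

theorem detForm_eq_mul_vol (a vv : Fin 8 → E8) :
    detForm a vv = Matrix.det (Matrix.of fun i j => a i j) * vol vv := by
  rw [detForm, vol, ← Matrix.det_mul]
  refine congrArg Matrix.det (Matrix.ext fun i j => ?_)
  simp [Matrix.mul_apply, PiLp.inner_apply, mul_comm]

/-- Laplace expansion of a determinant whose last rows are distinct standard basis vectors. -/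
theorem det_append_single {m n : ℕ} (A : Fin m → Fin (m + n) → ℝ)
    (π : Equiv.Perm (Fin (m + n))) :
    Matrix.det (Matrix.of (Fin.append A fun k => Pi.single (π (Fin.natAdd m k)) 1)) =
      ((Equiv.Perm.sign π : ℤ) : ℝ) *
        Matrix.det (Matrix.of fun i j => A i (π (Fin.castAdd n j))) := by
  set M := Matrix.of (Fin.append A fun k => Pi.single (π (Fin.natAdd m k)) 1) with hM
  have h1 : (M.submatrix id π).det = ((Equiv.Perm.sign π : ℤ) : ℝ) * M.det :=
    Matrix.det_permute' π M
  have h2 : (M.submatrix id π).det =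
      Matrix.det (Matrix.of fun i j => A i (π (Fin.castAdd n j))) := by
    have hblock : (M.submatrix id π).submatrix finSumFinEquiv finSumFinEquiv =
        Matrix.fromBlocks (Matrix.of fun i j => A i (π (Fin.castAdd n j)))
          (Matrix.of fun i j => A i (π (Fin.natAdd m j))) 0 1 := by
      ext i j
      rcases i with i | i
      · rcases j with j | j <;> simp [hM]
      · rcases j with j | j
        · have hne : Fin.castAdd n j ≠ Fin.natAdd m i := by
            simp only [ne_eq, Fin.ext_iff, Fin.val_castAdd, Fin.val_natAdd]
            omega
          simp [hM, hne]
        · simp [hM, Pi.single_apply, Matrix.one_apply, eq_comm]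
    rw [← Matrix.det_submatrix_equiv_self finSumFinEquiv, hblock,
      Matrix.det_fromBlocks_zero₂₁, Matrix.det_one, mul_one]
  rw [← h2, h1, ← mul_assoc, ← Int.cast_mul, ← Units.val_mul, Int.units_mul_self]
  simp

theorem wedge_detForm_dx4 (a : Fin 4 → E8) (vv : Fin 8 → E8) (π : Equiv.Perm (Fin 8))
    (hπ : Equiv.Perm.sign π = 1) :
    wedge (detForm a) (dx4 (π 4) (π 5) (π 6) (π 7)) vv =
      dx4 (π 0) (π 1) (π 2) (π 3) a * vol vv := by
  have h : (Matrix.of fun i j => (Fin.append a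
      ![stdVec (π 4), stdVec (π 5), stdVec (π 6), stdVec (π 7)] : Fin 8 → E8) i j) =
      Matrix.of (Fin.append (fun i j => a i j)
        fun k : Fin 4 => Pi.single (π (Fin.natAdd 4 k)) 1) := by
    ext i j
    fin_cases i <;> rfl
  rw [dx4_eq_detForm, wedge_detForm, detForm_eq_mul_vol, h, det_append_single, hπ, dx4,
    ← Matrix.det_transpose]
  congr 1
  simp only [Units.val_one, Int.cast_one, one_mul]
  refine congrArg Matrix.det (Matrix.ext fun i j => ?_)
  fin_cases i <;> rfl

theorem Phi0_eq : Phi0 = dx4 0 1 2 3 + dx4 0 1 4 5 + dx4 0 1 6 7 + dx4 0 2 4 6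
    - dx4 0 2 5 7 - dx4 0 3 4 7 - dx4 0 3 5 6 - dx4 1 2 4 7 - dx4 1 2 5 6 - dx4 1 3 4 6
    + dx4 1 3 5 7 + dx4 2 3 4 5 + dx4 2 3 6 7 + dx4 4 5 6 7 := rfl

theorem wedge_detForm_Phi0 (a : Fin 4 → E8) (vv : Fin 8 → E8) :
    wedge (detForm a) Phi0 vv = Phi0 a * vol vv := by
  simp only [Phi0_eq, wedge_add_right, wedge_sub_right, Pi.add_apply, Pi.sub_apply]
  rw [
    show wedge (detForm a) (dx4 0 1 2 3) vv = dx4 4 5 6 7 a * vol vv from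
      wedge_detForm_dx4 a vv ⟨![4, 5, 6, 7, 0, 1, 2, 3], ![4, 5, 6, 7, 0, 1, 2, 3], by decide, by decide⟩ (by decide),
    show wedge (detForm a) (dx4 0 1 4 5) vv = dx4 2 3 6 7 a * vol vv from
      wedge_detForm_dx4 a vv ⟨![2, 3, 6, 7, 0, 1, 4, 5], ![4, 5, 0, 1, 6, 7, 2, 3], by decide, by decide⟩ (by decide),
    show wedge (detForm a) (dx4 0 1 6 7) vv = dx4 2 3 4 5 a * vol vv from
      wedge_detForm_dx4 a vv ⟨![2, 3, 4, 5, 0, 1, 6, 7], ![4, 5, 0, 1, 2, 3, 6, 7], by decide, by decide⟩ (by decide),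
    show wedge (detForm a) (dx4 0 2 4 6) vv = dx4 1 3 5 7 a * vol vv from
      wedge_detForm_dx4 a vv ⟨![1, 3, 5, 7, 0, 2, 4, 6], ![4, 0, 5, 1, 6, 2, 7, 3], by decide, by decide⟩ (by decide),
    show wedge (detForm a) (dx4 0 2 5 7) vv = dx4 1 3 4 6 a * vol vv from
      wedge_detForm_dx4 a vv ⟨![1, 3, 4, 6, 0, 2, 5, 7], ![4, 0, 5, 1, 2, 6, 3, 7], by decide, by decide⟩ (by decide),
    show wedge (detForm a) (dx4 0 3 4 7) vv = dx4 1 2 5 6 a * vol vv from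
      wedge_detForm_dx4 a vv ⟨![1, 2, 5, 6, 0, 3, 4, 7], ![4, 0, 1, 5, 6, 2, 3, 7], by decide, by decide⟩ (by decide),
    show wedge (detForm a) (dx4 0 3 5 6) vv = dx4 1 2 4 7 a * vol vv from
      wedge_detForm_dx4 a vv ⟨![1, 2, 4, 7, 0, 3, 5, 6], ![4, 0, 1, 5, 2, 6, 7, 3], by decide, by decide⟩ (by decide),
    show wedge (detForm a) (dx4 1 2 4 7) vv = dx4 0 3 5 6 a * vol vv from
      wedge_detForm_dx4 a vv ⟨![0, 3, 5, 6, 1, 2, 4, 7], ![0, 4, 5, 1, 6, 2, 3, 7], by decide, by decide⟩ (by decide),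
    show wedge (detForm a) (dx4 1 2 5 6) vv = dx4 0 3 4 7 a * vol vv from
      wedge_detForm_dx4 a vv ⟨![0, 3, 4, 7, 1, 2, 5, 6], ![0, 4, 5, 1, 2, 6, 7, 3], by decide, by decide⟩ (by decide),
    show wedge (detForm a) (dx4 1 3 4 6) vv = dx4 0 2 5 7 a * vol vv from
      wedge_detForm_dx4 a vv ⟨![0, 2, 5, 7, 1, 3, 4, 6], ![0, 4, 1, 5, 6, 2, 7, 3], by decide, by decide⟩ (by decide),
    show wedge (detForm a) (dx4 1 3 5 7) vv = dx4 0 2 4 6 a * vol vv from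
      wedge_detForm_dx4 a vv ⟨![0, 2, 4, 6, 1, 3, 5, 7], ![0, 4, 1, 5, 2, 6, 3, 7], by decide, by decide⟩ (by decide),
    show wedge (detForm a) (dx4 2 3 4 5) vv = dx4 0 1 6 7 a * vol vv from
      wedge_detForm_dx4 a vv ⟨![0, 1, 6, 7, 2, 3, 4, 5], ![0, 1, 4, 5, 6, 7, 2, 3], by decide, by decide⟩ (by decide),
    show wedge (detForm a) (dx4 2 3 6 7) vv = dx4 0 1 4 5 a * vol vv from
      wedge_detForm_dx4 a vv ⟨![0, 1, 4, 5, 2, 3, 6, 7], ![0, 1, 4, 5, 2, 3, 6, 7], by decide, by decide⟩ (by decide),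
    show wedge (detForm a) (dx4 4 5 6 7) vv = dx4 0 1 2 3 a * vol vv from
      wedge_detForm_dx4 a vv ⟨![0, 1, 2, 3, 4, 5, 6, 7], ![0, 1, 2, 3, 4, 5, 6, 7], by decide, by decide⟩ (by decide)]
  ring

/-- Laplace expansion of `dx4` along its first two arguments. -/
theorem dx4_contract (i j k l : Fin 8) (u v : E8) :
    (fun z : Fin 2 → E8 => dx4 i j k l ![v, u, z 0, z 1]) =
      (v i * u j - v j * u i) • detForm ![stdVec k, stdVec l]
      - (v i * u k - v k * u i) • detForm ![stdVec j, stdVec l]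
      + (v i * u l - v l * u i) • detForm ![stdVec j, stdVec k]
      + (v j * u k - v k * u j) • detForm ![stdVec i, stdVec l]
      - (v j * u l - v l * u j) • detForm ![stdVec i, stdVec k]
      + (v k * u l - v l * u k) • detForm ![stdVec i, stdVec j] := by
  funext z
  simp [dx4, detForm, Matrix.det_succ_row_zero, Fin.sum_univ_succ, Fin.succAbove, inner_stdVec]
  ring

theorem wedge_detForm_flat_flat_Phi0 (a b y w : E8) (vv : Fin 8 → E8) :
    wedge (wedge (detForm ![a, b]) (wedge (flat y) (flat w))) Phi0 vv =
      Phi0 ![a, b, y, w] * vol vv := by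
  have h : wedge (detForm ![a, b]) (wedge (flat y) (flat w)) = detForm ![a, b, y, w] := by
    rw [flat_eq_detForm, flat_eq_detForm, wedge_detForm, wedge_detForm]
    congr 1
    funext i
    fin_cases i <;> rfl
  rw [h]
  exact wedge_detForm_Phi0 ![a, b, y, w] vv

theorem wedge_contract_Phi0 (i j k l : Fin 8) (u v y w : E8) (vv : Fin 8 → E8) :
    wedge (wedge (fun z => dx4 i j k l ![v, u, z 0, z 1]) (wedge (flat y) (flat w))) Phi0 vv =
      ((v i * u j - v j * u i) * Phi0 ![stdVec k, stdVec l, y, w]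
      - (v i * u k - v k * u i) * Phi0 ![stdVec j, stdVec l, y, w]
      + (v i * u l - v l * u i) * Phi0 ![stdVec j, stdVec k, y, w]
      + (v j * u k - v k * u j) * Phi0 ![stdVec i, stdVec l, y, w]
      - (v j * u l - v l * u j) * Phi0 ![stdVec i, stdVec k, y, w]
      + (v k * u l - v l * u k) * Phi0 ![stdVec i, stdVec j, y, w]) * vol vv := by
  simp only [dx4_contract, wedge_add_left, wedge_sub_left, wedge_smul_left,
    Pi.add_apply, Pi.sub_apply, Pi.smul_apply, smul_eq_mul, wedge_detForm_flat_flat_Phi0]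
  ring

theorem dx4_apply (i j k l : Fin 8) (a b c d : E8) :
    dx4 i j k l ![a, b, c, d] =
      (a i * b j - a j * b i) * (c k * d l - c l * d k)
      - (a i * b k - a k * b i) * (c j * d l - c l * d j)
      + (a i * b l - a l * b i) * (c j * d k - c k * d j)
      + (a j * b k - a k * b j) * (c i * d l - c l * d i)
      - (a j * b l - a l * b j) * (c i * d k - c k * d i)
      + (a k * b l - a l * b k) * (c i * d j - c j * d i) := by
  simp [dx4, Matrix.det_succ_row_zero, Fin.sum_univ_succ, Fin.succAbove]
  ring

/-- For all `u, v, y, w ∈ ℝ⁸`, with `A = ⟨u,y⟩⟨v,w⟩ − ⟨u,w⟩⟨v,y⟩` and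
`B = Φ₀(u,v,y,w)`, one has `(ι_u ι_v Φ₀) ∧ (y♭ ∧ w♭) ∧ Φ₀ = (−3A − 2B) · vol`. -/
theorem contraction_wedge_flat_wedge_Phi (u v y w : E8) (vv : Fin 8 → E8) :
    wedge (wedge (iota2 u v) (wedge (flat y) (flat w))) Phi0 vv =
      (-3 * (⟪u, y⟫ * ⟪v, w⟫ - ⟪u, w⟫ * ⟪v, y⟫) - 2 * Phi0 ![u, v, y, w]) * vol vv := by
  have hι : iota2 u v =
      (fun z => dx4 0 1 2 3 ![v, u, z 0, z 1]) + (fun z => dx4 0 1 4 5 ![v, u, z 0, z 1])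
      + (fun z => dx4 0 1 6 7 ![v, u, z 0, z 1]) + (fun z => dx4 0 2 4 6 ![v, u, z 0, z 1])
      - (fun z => dx4 0 2 5 7 ![v, u, z 0, z 1]) - (fun z => dx4 0 3 4 7 ![v, u, z 0, z 1])
      - (fun z => dx4 0 3 5 6 ![v, u, z 0, z 1]) - (fun z => dx4 1 2 4 7 ![v, u, z 0, z 1])
      - (fun z => dx4 1 2 5 6 ![v, u, z 0, z 1]) - (fun z => dx4 1 3 4 6 ![v, u, z 0, z 1])
      + (fun z => dx4 1 3 5 7 ![v, u, z 0, z 1]) + (fun z => dx4 2 3 4 5 ![v, u, z 0, z 1])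
      + (fun z => dx4 2 3 6 7 ![v, u, z 0, z 1]) + (fun z => dx4 4 5 6 7 ![v, u, z 0, z 1]) :=
    rfl
  simp only [hι, wedge_add_left, wedge_sub_left, Pi.add_apply, Pi.sub_apply,
    wedge_contract_Phi0, ← add_mul, ← sub_mul]
  congr 1
  simp only [Phi0, dx4_apply, PiLp.inner_apply, Fin.sum_univ_eight, RCLike.inner_apply,
    conj_trivial, PiLp.single_apply, Fin.reduceEq, if_true, if_false, mul_zero,
    zero_mul, sub_zero, zero_sub, mul_one, one_mul, add_zero, zero_add]
  ring
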